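/- arXiv:2512.17258 — 3 statements merged into one kernel-verified Lean document; each statement's English description precedes it below -/
import Mathlib

section
/- Let A be a real symmetric n×n matrix (n ≥ 1) with k_A = |ev_M(A)\{−2}| ≥ 1, and let λ₁ > λ₂ > … > λ_{k_A} be the zeroes of ω_A. Then ψ_A is continuous and strictly increasing on each of the k_A+1 maximal intervals (−∞, λ_{k_A}), (λ_{k_A}, λ_{k_A−1}), …, (λ₂, λ₁), (λ₁, +∞), and satisfies lim_{λ→+∞} ψ_A(λ) = +∞, lim_{λ→−∞} ψ_A(λ) = −∞, and for each 1 ≤ i ≤ k_A, lim_{λ↓λ_i} ψ_A(λ) = −∞ and lim_{λ↑λ_i} ψ_A(λ) = +∞. -/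
open scoped BigOperators
open Filter Topology
open scoped Classical

namespace QECPaper

/-- The cone (join) `K₁ + H` over a graph `H`: vertex `none` is the apex. -/
def cone {V₂ : Type*} (H : SimpleGraph V₂) : SimpleGraph (Option V₂) where
  Adj x y := (∃ a b, x = some a ∧ y = some b ∧ H.Adj a b) ∨
    (x = none ∧ y ≠ none) ∨ (x ≠ none ∧ y = none)
  symm := by
    refine ⟨?_⟩
    rintro x y (⟨a, b, rfl, rfl, h⟩ | ⟨rfl, hy⟩ | ⟨hx, rfl⟩)
    · exact Or.inl ⟨b, a, rfl, rfl, h.symm⟩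
    · exact Or.inr (Or.inr ⟨hy, rfl⟩)
    · exact Or.inr (Or.inl ⟨rfl, hx⟩)
  loopless := by
    refine ⟨?_⟩
    rintro x (⟨a, b, rfl, hb, h⟩ | ⟨rfl, hy⟩ | ⟨hx, rfl⟩)
    · exact H.loopless.irrefl a (by cases hb; exact h)
    · exact hy rfl
    · exact hx rfl

/-- The corona `G ⊙ H` of two graphs, realized on `V₁ × ({o} ∪ V₂)`
with `o = none`. -/
def corona {V₁ V₂ : Type*} (G : SimpleGraph V₁) (H : SimpleGraph V₂) :
    SimpleGraph (V₁ × Option V₂) where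
  Adj p q := (p.1 = q.1 ∧ (cone H).Adj p.2 q.2) ∨
    (G.Adj p.1 q.1 ∧ p.2 = none ∧ q.2 = none)
  symm := by
    refine ⟨?_⟩
    rintro ⟨i, x⟩ ⟨j, y⟩ (⟨h1, h2⟩ | ⟨h1, h2, h3⟩)
    · exact Or.inl ⟨h1.symm, (cone H).symm.symm _ _ h2⟩
    · exact Or.inr ⟨h1.symm, h3, h2⟩
  loopless := by
    refine ⟨?_⟩
    rintro ⟨i, x⟩ (⟨h1, h2⟩ | ⟨h1, h2, h3⟩)
    · exact (cone H).loopless.irrefl x h2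
    · exact G.loopless.irrefl i h1

/-- The quadratic embedding constant of a (connected) graph on a finite vertex set. -/
noncomputable def QEC {V : Type*} [Fintype V] (G : SimpleGraph V) : ℝ :=
  sSup {r : ℝ | ∃ f : V → ℝ, (∑ x, f x ^ 2) = 1 ∧ (∑ x, f x) = 0 ∧
    r = ∑ x, ∑ y, f x * (G.dist x y : ℝ) * f y}

/-- The set `λ(S)` of `λ` appearing in a solution of the basic equations. -/
def lambdaS {V : Type*} [Fintype V] (G : SimpleGraph V) : Set ℝ :=
  {lam : ℝ | ∃ (f : V → ℝ) (μ : ℝ),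
    (∀ x, (∑ y, (G.dist x y : ℝ) * f y) - lam * f x = μ / 2) ∧
    (∑ x, f x) = 0 ∧ (∑ x, f x ^ 2) = 1}

/-- The distance matrix of a graph, with real entries. -/
noncomputable def distMatrix {V : Type*} (G : SimpleGraph V) : Matrix V V ℝ :=
  Matrix.of fun x y => (G.dist x y : ℝ)

section MatrixFunctions

variable {ι : Type*} [Fintype ι] [DecidableEq ι]

/-- The eigenspace `ker (A - α)` inside `EuclideanSpace ℝ ι`. -/
noncomputable def eigSpace (A : Matrix ι ι ℝ) (α : ℝ) :
    Submodule ℝ (EuclideanSpace ℝ ι) :=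
  LinearMap.ker (Matrix.toEuclideanLin A - α • LinearMap.id)

/-- The all-ones vector of `EuclideanSpace ℝ ι`. -/
noncomputable def onesE (ι : Type*) [Fintype ι] : EuclideanSpace ℝ ι :=
  (WithLp.equiv 2 (ι → ℝ)).symm (fun _ => 1)

/-- `‖E_α 𝟏‖²`, where `E_α` is the orthogonal projection of `EuclideanSpace ℝ ι`
onto the eigenspace `ker (A - α)`. -/
noncomputable def projNormSq (A : Matrix ι ι ℝ) (α : ℝ) : ℝ :=
  ‖(Submodule.orthogonalProjectionOnto (eigSpace A α) (onesE ι) : EuclideanSpace ℝ ι)‖ ^ 2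

/-- The set of (real) eigenvalues of a matrix. -/
def evSet (A : Matrix ι ι ℝ) : Set ℝ :=
  {α : ℝ | ∃ v : ι → ℝ, v ≠ 0 ∧ A.mulVec v = α • v}

/-- The set of main eigenvalues: those `α` with `E_α 𝟏 ≠ 0`. -/
def mainEv (A : Matrix ι ι ℝ) : Set ℝ := {α : ℝ | projNormSq A α ≠ 0}

/-- `k_A = |ev_M(A) \ {-2}|`. -/
noncomputable def kA (A : Matrix ι ι ℝ) : ℕ := (mainEv A \ {(-2 : ℝ)}).ncard

/-- The ω-function associated with the symmetric matrix `A`. -/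
noncomputable def omegaFun (A : Matrix ι ι ℝ) (lam : ℝ) : ℝ :=
  1 + projNormSq A (-2) +
    ∑ᶠ α ∈ mainEv A \ {(-2 : ℝ)}, lam / (α + 2 + lam) * projNormSq A α

/-- The (maximal) domain of the ω-function: the complement of its poles. -/
def omegaDomain (A : Matrix ι ι ℝ) : Set ℝ :=
  {lam : ℝ | ∀ α ∈ mainEv A \ {(-2 : ℝ)}, lam ≠ -α - 2}

/-- The set of zeroes of the ω-function (on its domain). -/
def omegaZeros (A : Matrix ι ι ℝ) : Set ℝ :=
  {lam : ℝ | lam ∈ omegaDomain A ∧ omegaFun A lam = 0}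

/-- `λ*`, the largest zero of the ω-function. -/
noncomputable def lamStar (A : Matrix ι ι ℝ) : ℝ := sSup (omegaZeros A)

/-- The ψ-function associated with `A`: `ψ_A(λ) = λ/ω_A(λ)` extended
analytically across the poles of `ω_A` by the value `0`. -/
noncomputable def psiFun (A : Matrix ι ι ℝ) (lam : ℝ) : ℝ :=
  if -lam - 2 ∈ mainEv A \ {(-2 : ℝ)} then 0 else lam / omegaFun A lam

/-- The inverse of the rightmost branch `ψ_{A*} = ψ_A ↾ (λ*, +∞)`:
`ψ_{A*}⁻¹(y)` is the unique `λ > λ*` with `ψ_A(λ) = y`. -/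
noncomputable def psiStarInv (A : Matrix ι ι ℝ) (y : ℝ) : ℝ :=
  sSup {lam : ℝ | lamStar A < lam ∧ psiFun A lam = y}

end MatrixFunctions


/-- The finite sum of simple fractions `∑ p ∈ P, w p / (x - p)`. -/
noncomputable def poleSum (P : Finset ℝ) (w : ℝ → ℝ) (x : ℝ) : ℝ :=
  ∑ p ∈ P, w p / (x - p)

/-- The reciprocal of `poleSum P w`, extended by `0` at the poles. -/
noncomputable def invPoleSum (P : Finset ℝ) (w : ℝ → ℝ) (x : ℝ) : ℝ :=
  if x ∈ P then 0 else (poleSum P w x)⁻¹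

section PoleSum

variable {P : Finset ℝ} {w : ℝ → ℝ} {x : ℝ}

lemma hasDerivAt_poleSum (hx : x ∉ P) :
    HasDerivAt (poleSum P w) (∑ p ∈ P, -(w p / (x - p) ^ 2)) x := by
  have h : HasDerivAt (fun y => ∑ p ∈ P, w p / (y - p))
      (∑ p ∈ P, -(w p / (x - p) ^ 2)) x := by
    refine HasDerivAt.fun_sum fun p hp => ?_
    have hne : x - p ≠ 0 := sub_ne_zero.2 fun h => hx (h ▸ hp)
    refine ((hasDerivAt_const x (w p)).div ((hasDerivAt_id x).sub_const p) hne).congr_deriv ?_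
    simp [neg_div]
  exact h

lemma deriv_poleSum_neg (hP : P.Nonempty) (hw : ∀ p ∈ P, 0 < w p) (hx : x ∉ P) :
    deriv (poleSum P w) x < 0 := by
  rw [(hasDerivAt_poleSum hx).deriv]
  refine Finset.sum_neg (fun p hp => ?_) hP
  have hne : x - p ≠ 0 := sub_ne_zero.2 fun h => hx (h ▸ hp)
  have := hw p hp
  exact neg_neg_of_pos (by positivity)

lemma eventually_notMem_finset (hx : x ∉ P) : ∀ᶠ y in 𝓝 x, y ∉ P :=
  P.finite_toSet.isClosed.isOpen_compl.mem_nhds hx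

lemma invPoleSum_eventuallyEq (hx : x ∉ P) :
    invPoleSum P w =ᶠ[𝓝 x] fun y => (poleSum P w y)⁻¹ := by
  filter_upwards [eventually_notMem_finset hx] with y hy
  simp [invPoleSum, hy]

/-- Near a pole, the reciprocal is a quotient with nonvanishing denominator. -/
lemma invPoleSum_eventuallyEq_of_mem (hx : x ∈ P) :
    invPoleSum P w =ᶠ[𝓝 x]
      fun y => (y - x) / (w x + (y - x) * poleSum (P.erase x) w y) := by
  filter_upwards [eventually_notMem_finset (Finset.notMem_erase x P)] with y hy
  by_cases hyx : y = x
  · subst hyx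
    simp [invPoleSum, hx]
  · have hyP : y ∉ P := fun h => hy (Finset.mem_erase.2 ⟨hyx, h⟩)
    have hne : y - x ≠ 0 := sub_ne_zero.2 hyx
    have hsum : poleSum P w y = w x / (y - x) + poleSum (P.erase x) w y :=
      (Finset.add_sum_erase P (fun p => w p / (y - p)) hx).symm
    rw [invPoleSum, if_neg hyP, hsum, div_add' _ _ _ hne, inv_div, mul_comm (y - x)]

/-- Off the zeros of the pole sum, its extended reciprocal has positive derivative. -/
lemma exists_hasDerivAt_invPoleSum (hP : P.Nonempty) (hw : ∀ p ∈ P, 0 < w p)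
    (hx : x ∉ P → poleSum P w x ≠ 0) :
    ∃ d, 0 < d ∧ HasDerivAt (invPoleSum P w) d x := by
  by_cases hxP : x ∈ P
  · have hwx := hw x hxP
    have hlin : HasDerivAt (fun y : ℝ => y - x) 1 x := (hasDerivAt_id x).sub_const x
    have hden := (hlin.mul (hasDerivAt_poleSum (w := w)
      (Finset.notMem_erase x P))).const_add (w x)
    refine ⟨1 / w x, by positivity, ?_⟩
    refine ((hlin.div hden (by simpa using hwx.ne')).congr_deriv ?_).congr_of_eventuallyEq
      (invPoleSum_eventuallyEq_of_mem hxP)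
    simp [sq]
  · have hd := deriv_poleSum_neg hP hw hxP
    have hne := hx hxP
    refine ⟨_, ?_, ((hasDerivAt_poleSum hxP).differentiableAt.hasDerivAt.fun_inv
      hne).congr_of_eventuallyEq (invPoleSum_eventuallyEq hxP)⟩
    exact div_pos (neg_pos.2 hd) (by positivity)

lemma invPoleSum_continuousOn_strictMonoOn (hP : P.Nonempty) (hw : ∀ p ∈ P, 0 < w p)
    {I : Set ℝ} (hI : Convex ℝ I) (h : ∀ x ∈ I, x ∉ P → poleSum P w x ≠ 0) :
    ContinuousOn (invPoleSum P w) I ∧ StrictMonoOn (invPoleSum P w) I := by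
  have hcont : ContinuousOn (invPoleSum P w) I := fun x hx => by
    obtain ⟨d, -, hd⟩ := exists_hasDerivAt_invPoleSum hP hw (h x hx)
    exact hd.continuousAt.continuousWithinAt
  refine ⟨hcont, strictMonoOn_of_deriv_pos hI hcont fun x hx => ?_⟩
  obtain ⟨d, hd0, hd⟩ := exists_hasDerivAt_invPoleSum hP hw (h x (interior_subset hx))
  rwa [hd.deriv]

lemma tendsto_invPoleSum_atTop (hP : P.Nonempty) (hw : ∀ p ∈ P, 0 < w p) :
    Tendsto (invPoleSum P w) atTop atTop := by
  have hlarge : ∀ᶠ y : ℝ in atTop, ∀ p ∈ P, p < y :=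
    (Finset.eventually_all P).2 fun p _ => eventually_gt_atTop p
  have h0 : Tendsto (poleSum P w) atTop (𝓝 0) := by
    have : Tendsto (fun y => ∑ p ∈ P, w p / (y - p)) atTop (𝓝 (∑ p ∈ P, 0)) :=
      tendsto_finsetSum P fun p _ => tendsto_const_nhds.div_atTop
        (tendsto_atTop_add_const_right _ (-p) tendsto_id)
    rwa [Finset.sum_const_zero] at this
  have hpos : ∀ᶠ y in atTop, poleSum P w y ∈ Set.Ioi 0 := by
    filter_upwards [hlarge] with y hy
    exact Finset.sum_pos (fun p hp => div_pos (hw p hp) (sub_pos.2 (hy p hp))) hP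
  refine (tendsto_inv_nhdsGT_zero.comp (tendsto_nhdsWithin_iff.2 ⟨h0, hpos⟩)).congr' ?_
  filter_upwards [hlarge] with y hy
  simp [invPoleSum, show y ∉ P from fun h => (hy y h).false]

lemma tendsto_invPoleSum_atBot (hP : P.Nonempty) (hw : ∀ p ∈ P, 0 < w p) :
    Tendsto (invPoleSum P w) atBot atBot := by
  have hsmall : ∀ᶠ y : ℝ in atBot, ∀ p ∈ P, y < p :=
    (Finset.eventually_all P).2 fun p _ => eventually_lt_atBot p
  have h0 : Tendsto (poleSum P w) atBot (𝓝 0) := by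
    have : Tendsto (fun y => ∑ p ∈ P, w p / (y - p)) atBot (𝓝 (∑ p ∈ P, 0)) :=
      tendsto_finsetSum P fun p _ => tendsto_const_nhds.div_atBot
        (tendsto_atBot_add_const_right _ (-p) tendsto_id)
    rwa [Finset.sum_const_zero] at this
  have hneg : ∀ᶠ y in atBot, poleSum P w y ∈ Set.Iio 0 := by
    filter_upwards [hsmall] with y hy
    exact Finset.sum_neg (fun p hp => div_neg_of_pos_of_neg (hw p hp)
      (sub_neg.2 (hy p hp))) hP
  refine (tendsto_inv_nhdsLT_zero.comp (tendsto_nhdsWithin_iff.2 ⟨h0, hneg⟩)).congr' ?_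
  filter_upwards [hsmall] with y hy
  simp [invPoleSum, show y ∉ P from fun h => (hy y h).false]

lemma tendsto_invPoleSum_of_zero (hP : P.Nonempty) (hw : ∀ p ∈ P, 0 < w p)
    (hx : x ∉ P) (h0 : poleSum P w x = 0) :
    Tendsto (invPoleSum P w) (𝓝[>] x) atBot ∧ Tendsto (invPoleSum P w) (𝓝[<] x) atTop := by
  have hsign := eventually_nhdsWithin_sign_eq_of_deriv_neg (deriv_poleSum_neg hP hw hx) h0
  have hlim : Tendsto (poleSum P w) (𝓝 x) (𝓝 0) :=
    h0 ▸ (hasDerivAt_poleSum hx).continuousAt.tendsto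
  have heq := (invPoleSum_eventuallyEq (w := w) hx).symm
  constructor
  · refine (tendsto_inv_nhdsLT_zero.comp (tendsto_nhdsWithin_iff.2
      ⟨hlim.mono_left nhdsWithin_le_nhds, ?_⟩)).congr' (heq.filter_mono nhdsWithin_le_nhds)
    filter_upwards [hsign.filter_mono nhdsWithin_le_nhds, self_mem_nhdsWithin] with y hy hxy
    rwa [sign_neg (sub_neg.2 hxy), sign_eq_neg_one_iff] at hy
  · refine (tendsto_inv_nhdsGT_zero.comp (tendsto_nhdsWithin_iff.2
      ⟨hlim.mono_left nhdsWithin_le_nhds, ?_⟩)).congr' (heq.filter_mono nhdsWithin_le_nhds)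
    filter_upwards [hsign.filter_mono nhdsWithin_le_nhds, self_mem_nhdsWithin] with y hy hxy
    rwa [sign_pos (sub_pos.2 hxy), sign_eq_one_iff] at hy

end PoleSum

section PsiFun

variable {ι : Type*} [Fintype ι] [DecidableEq ι] {A : Matrix ι ι ℝ}

lemma projNormSq_nonneg (A : Matrix ι ι ℝ) (α : ℝ) : 0 ≤ projNormSq A α :=
  sq_nonneg _

/-- The poles of `ω_A(x) / x`. -/
noncomputable def psiPoles (hfin : (mainEv A \ {(-2 : ℝ)}).Finite) : Finset ℝ :=
  insert 0 (hfin.toFinset.image fun α => -α - 2)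

/-- The residues of `ω_A(x) / x`. -/
noncomputable def psiResidue (A : Matrix ι ι ℝ) (p : ℝ) : ℝ :=
  if p = 0 then 1 + projNormSq A (-2) else projNormSq A (-p - 2)

variable (hfin : (mainEv A \ {(-2 : ℝ)}).Finite)

lemma mem_psiPoles {x : ℝ} :
    x ∈ psiPoles hfin ↔ x = 0 ∨ -x - 2 ∈ mainEv A \ {(-2 : ℝ)} := by
  rw [psiPoles, Finset.mem_insert, Finset.mem_image]
  refine or_congr_right ⟨?_, fun h => ⟨-x - 2, hfin.mem_toFinset.2 h, by ring⟩⟩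
  rintro ⟨α, hα, rfl⟩
  rw [hfin.mem_toFinset] at hα
  convert hα using 1
  ring

lemma psiPoles_nonempty : (psiPoles hfin).Nonempty :=
  Finset.insert_nonempty _ _

lemma psiResidue_pos : ∀ p ∈ psiPoles hfin, 0 < psiResidue A p := by
  intro p hp
  unfold psiResidue
  split_ifs with h
  · linarith [projNormSq_nonneg A (-2)]
  · exact (projNormSq_nonneg A _).lt_of_ne'
      (((mem_psiPoles hfin).1 hp).resolve_left h).1

lemma omegaFun_eq_mul_poleSum {x : ℝ} (hx : x ≠ 0) :
    omegaFun A x = x * poleSum (psiPoles hfin) (psiResidue A) x := by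
  have hnot : (0 : ℝ) ∉ hfin.toFinset.image fun α => -α - 2 := by
    rw [Finset.mem_image]
    rintro ⟨α, hα, h⟩
    exact (hfin.mem_toFinset.1 hα).2 (by simp only [Set.mem_singleton_iff]; linarith)
  rw [omegaFun, finsum_mem_eq_finite_toFinset_sum _ hfin, poleSum, psiPoles,
    Finset.sum_insert hnot, Finset.sum_image fun a _ b _ h => by linarith, mul_add,
    Finset.mul_sum]
  congr 1
  · rw [psiResidue, if_pos rfl, sub_zero, mul_div_cancel₀ _ hx]
  · refine Finset.sum_congr rfl fun α hα => ?_
    have hα2 : -α - 2 ≠ 0 := fun h =>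
      (hfin.mem_toFinset.1 hα).2 (by simp only [Set.mem_singleton_iff]; linarith)
    rw [psiResidue, if_neg hα2, show -(-α - 2) - 2 = α by ring,
      show x - (-α - 2) = α + 2 + x by ring, div_mul_eq_mul_div, mul_div_assoc]

lemma psiFun_eq_invPoleSum : psiFun A = invPoleSum (psiPoles hfin) (psiResidue A) := by
  funext x
  rw [psiFun, invPoleSum]
  by_cases hM : -x - 2 ∈ mainEv A \ {(-2 : ℝ)}
  · rw [if_pos hM, if_pos ((mem_psiPoles hfin).2 (Or.inr hM))]
  · rw [if_neg hM]
    by_cases hx : x = 0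
    · rw [if_pos ((mem_psiPoles hfin).2 (Or.inl hx)), hx, zero_div]
    · rw [if_neg fun h => ((mem_psiPoles hfin).1 h).elim hx hM,
        omegaFun_eq_mul_poleSum hfin hx, div_mul_cancel_left₀ hx]

lemma mem_omegaDomain_iff {x : ℝ} :
    x ∈ omegaDomain A ↔ -x - 2 ∉ mainEv A \ {(-2 : ℝ)} := by
  refine ⟨fun h hx => h _ hx (by ring), fun h α hα hx => h ?_⟩
  rwa [hx, show -(-α - 2) - 2 = α by ring]

lemma mem_omegaZeros_iff {x : ℝ} : x ∈ omegaZeros A ↔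
    x ∉ psiPoles hfin ∧ poleSum (psiPoles hfin) (psiResidue A) x = 0 := by
  rw [omegaZeros, Set.mem_ofPred_eq, mem_omegaDomain_iff, mem_psiPoles, not_or]
  by_cases hx : x = 0
  · have h0 : omegaFun A 0 ≠ 0 := by
      simp only [omegaFun, zero_div, zero_mul, finsum_mem_zero, add_zero]
      linarith [projNormSq_nonneg A (-2)]
    simp [hx, h0]
  · simp [omegaFun_eq_mul_poleSum hfin hx, hx]

end PsiFun

/-- Behaviour of the ψ-function of a symmetric matrix. -/
theorem psiFun_behaviour {n : ℕ} (hn : 1 ≤ n)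
    (A : Matrix (Fin n) (Fin n) ℝ) (hA : A.IsSymm)
    (k : ℕ) (hkk : kA A = k) (hk : 1 ≤ k)
    (lamz : Fin k → ℝ) (hanti : StrictAnti lamz)
    (hrange : Set.range lamz = omegaZeros A) :
    (ContinuousOn (psiFun A) (Set.Iio (lamz ⟨k - 1, by omega⟩)) ∧
      StrictMonoOn (psiFun A) (Set.Iio (lamz ⟨k - 1, by omega⟩))) ∧
    (∀ (i : Fin k) (h : i.val + 1 < k),
      ContinuousOn (psiFun A) (Set.Ioo (lamz ⟨i.val + 1, h⟩) (lamz i)) ∧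
      StrictMonoOn (psiFun A) (Set.Ioo (lamz ⟨i.val + 1, h⟩) (lamz i))) ∧
    (ContinuousOn (psiFun A) (Set.Ioi (lamz ⟨0, hk⟩)) ∧
      StrictMonoOn (psiFun A) (Set.Ioi (lamz ⟨0, hk⟩))) ∧
    Tendsto (psiFun A) atTop atTop ∧
    Tendsto (psiFun A) atBot atBot ∧
    (∀ i : Fin k,
      Tendsto (psiFun A) (𝓝[>] (lamz i)) atBot ∧
      Tendsto (psiFun A) (𝓝[<] (lamz i)) atTop) := by
  have hfin : (mainEv A \ {(-2 : ℝ)}).Finite :=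
    Set.finite_of_ncard_pos (by rw [← kA, hkk]; exact hk)
  have hP := psiPoles_nonempty hfin
  have hw := psiResidue_pos hfin
  have hzero : ∀ i, lamz i ∉ psiPoles hfin ∧
      poleSum (psiPoles hfin) (psiResidue A) (lamz i) = 0 := fun i =>
    (mem_omegaZeros_iff hfin).1 (hrange ▸ Set.mem_range_self i)
  have hmono : ∀ I : Set ℝ, Convex ℝ I → (∀ j, lamz j ∉ I) →
      ContinuousOn (psiFun A) I ∧ StrictMonoOn (psiFun A) I := by
    intro I hI hj
    rw [psiFun_eq_invPoleSum hfin]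
    refine invPoleSum_continuousOn_strictMonoOn hP hw hI fun x hx hxP h0 => ?_
    have hxz := (mem_omegaZeros_iff hfin).2 ⟨hxP, h0⟩
    rw [← hrange] at hxz
    obtain ⟨j, rfl⟩ := hxz
    exact hj j hx
  refine ⟨hmono _ (convex_Iio _) fun j hj => ?_,
    fun i h => hmono _ (convex_Ioo _ _) fun j hj => ?_,
    hmono _ (convex_Ioi _) fun j hj => ?_, ?_, ?_, fun i => ?_⟩
  · have h := hanti.lt_iff_gt.1 (Set.mem_Iio.1 hj)
    have := j.isLt
    simp only [Fin.lt_def] at h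
    omega
  · have h1 := hanti.lt_iff_gt.1 hj.1
    have h2 := hanti.lt_iff_gt.1 hj.2
    simp only [Fin.lt_def] at h1 h2
    omega
  · have h := hanti.lt_iff_gt.1 (Set.mem_Ioi.1 hj)
    simp [Fin.lt_def] at h
  · rw [psiFun_eq_invPoleSum hfin]
    exact tendsto_invPoleSum_atTop hP hw
  · rw [psiFun_eq_invPoleSum hfin]
    exact tendsto_invPoleSum_atBot hP hw
  · rw [psiFun_eq_invPoleSum hfin]
    exact tendsto_invPoleSum_of_zero hP hw (hzero i).1 (hzero i).2

end QECPaper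
end

section
/- Let A be a real symmetric n×n matrix (n ≥ 1) with k_A = |ev_M(A)\{−2}| ≥ 1, λ* the largest zero of ω_A, and ψ_{A*} the restriction of ψ_A to (λ*, +∞). Then: (1) the inverse ψ_{A*}⁻¹ is a strictly increasing function on all of ℝ with lim_{λ'→−∞} ψ_{A*}⁻¹(λ') = λ* and lim_{λ'→+∞} ψ_{A*}⁻¹(λ') = +∞; (2) ψ_{A*}⁻¹(0) = −α₁−2, where α₁ = min(ev_M(A) ∪ {−2}); (3) for every λ' ∈ ℝ, ψ_{A*}⁻¹(λ') = max{λ ∈ ℝ : ψ_A(λ) = λ'}. -/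
open scoped BigOperators
open Filter Topology
open scoped Classical

namespace QECPaper

/-- The function `(a + 2 + x) / ψ(x)` for `1 / ψ(x) = c a / (a + 2 + x) + ∑ α ∈ T, c α / (α + 2 + x)`.
It has no singularity at the pole `x = -a - 2`. -/
noncomputable def branchDenom (T : Finset ℝ) (c : ℝ → ℝ) (a x : ℝ) : ℝ :=
  c a + ∑ α ∈ T, c α * ((a + 2 + x) / (α + 2 + x))

section Branch

variable {T : Finset ℝ} {c : ℝ → ℝ} {a r : ℝ}

lemma branchDenom_continuousOn (hr : ∀ α ∈ T, 0 < α + 2 + r) :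
    ContinuousOn (branchDenom T c a) (Set.Ici r) := by
  unfold branchDenom
  refine continuousOn_const.add (continuousOn_finsetSum _ fun α hα => ?_)
  refine continuousOn_const.mul (ContinuousOn.div (by fun_prop) (by fun_prop) fun x hx => ?_)
  have := hr α hα
  have : r ≤ x := hx
  linarith

lemma div_strictMono_of_lt {α x y : ℝ} (ha : a < α) (hx : 0 < α + 2 + x) (hxy : x < y) :
    (a + 2 + x) / (α + 2 + x) < (a + 2 + y) / (α + 2 + y) := by
  rw [div_lt_div_iff₀ hx (by linarith)]
  nlinarith

lemma branchDenom_lt (hT : T.Nonempty) (hc : ∀ α ∈ T, 0 < c α) (ha : ∀ α ∈ T, a < α)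
    {x y : ℝ} (hx : ∀ α ∈ T, 0 < α + 2 + x) (hxy : x < y) :
    branchDenom T c a x < branchDenom T c a y := by
  unfold branchDenom
  exact add_lt_add_right (Finset.sum_lt_sum_of_nonempty hT fun α hα =>
    mul_lt_mul_of_pos_left (div_strictMono_of_lt (ha α hα) (hx α hα) hxy) (hc α hα)) _

lemma branchDenom_at_pole : branchDenom T c a (-a - 2) = c a := by
  simp [branchDenom]

/-- Right of all other poles, `branchDenom` has a zero `r`, and `r` lies left of `-a - 2`. -/
lemma exists_branchDenom_eq_zero (hT : T.Nonempty) (hca : 0 < c a) (hc : ∀ α ∈ T, 0 < c α)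
    (ha : ∀ α ∈ T, a < α) :
    ∃ r, a + 2 + r < 0 ∧ (∀ α ∈ T, 0 < α + 2 + r) ∧ branchDenom T c a r = 0 := by
  set b := T.min' hT
  have hb : b ∈ T := T.min'_mem hT
  have hbmin : ∀ α ∈ T, b ≤ α := fun α hα => T.min'_le α hα
  have hab := ha b hb
  set C := c a + ∑ α ∈ T, c α
  have hcb : c b ≤ ∑ α ∈ T, c α :=
    Finset.single_le_sum (fun α hα => (hc α hα).le) hb
  have hcb0 := hc b hb
  have hC0 : 0 < C := by linarith
  set ε := c b * (b - a) / C with hε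
  have hε0 : 0 < ε := by
    have : 0 < b - a := by linarith
    positivity
  have hεlt : ε < b - a := by
    rw [hε, div_lt_iff₀ hC0]
    nlinarith
  have hpos : ∀ α ∈ T, 0 < α + 2 + (-b - 2 + ε) := fun α hα => by
    have := hbmin α hα
    linarith
  have hle : branchDenom T c a (-b - 2 + ε) ≤ 0 := by
    have hsum : ∑ α ∈ T, c α * ((a + 2 + (-b - 2 + ε)) / (α + 2 + (-b - 2 + ε)))
        ≤ ∑ α ∈ T, (c α - if α = b then C else 0) := by
      refine Finset.sum_le_sum fun α hα => ?_
      have hα0 := hpos α hα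
      split_ifs with h
      · rw [h]
        have h1 : b + 2 + (-b - 2 + ε) = ε := by ring
        have h2 : a + 2 + (-b - 2 + ε) = ε - (b - a) := by ring
        rw [h1, h2, sub_div, div_self hε0.ne']
        have h3 : c b * ((b - a) / ε) = C := by
          have : ε * C = c b * (b - a) := by rw [hε]; field_simp
          field_simp
          linarith
        linarith
      · rw [sub_zero]
        refine mul_le_of_le_one_right (hc α hα).le ?_
        rw [div_le_one hα0]
        have := ha α hα
        linarith
    rw [Finset.sum_sub_distrib, Finset.sum_ite_eq' T b, if_pos hb] at hsum
    unfold branchDenom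
    linarith
  have hcont : ContinuousOn (branchDenom T c a) (Set.Icc (-b - 2 + ε) (-a - 2)) :=
    (branchDenom_continuousOn hpos).mono Set.Icc_subset_Ici_self
  obtain ⟨r, ⟨hr1, hr2⟩, hr0⟩ := intermediate_value_Icc (by linarith) hcont
    (show (0 : ℝ) ∈ Set.Icc _ _ from ⟨hle, by rw [branchDenom_at_pole]; exact hca.le⟩)
  refine ⟨r, ?_, fun α hα => by linarith [hpos α hα], hr0⟩
  rcases hr2.lt_or_eq with h | h
  · linarith
  · rw [h, branchDenom_at_pole] at hr0
    linarith

lemma branch_strictMono (hT : T.Nonempty) (hca : 0 < c a) (hc : ∀ α ∈ T, 0 < c α)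
    (ha : ∀ α ∈ T, a < α) (hr : ∀ α ∈ T, 0 < α + 2 + r) (hr0 : branchDenom T c a r = 0) :
    StrictMonoOn (fun x => (a + 2 + x) / branchDenom T c a x) (Set.Ioi r) := by
  intro x hx y hy hxy
  have hx : r < x := hx
  have hy : r < y := hy
  have hHx : 0 < branchDenom T c a x := hr0 ▸ branchDenom_lt hT hc ha hr hx
  have hHy : 0 < branchDenom T c a y := hr0 ▸ branchDenom_lt hT hc ha hr hy
  simp only
  rw [div_lt_div_iff₀ hHx hHy]
  rcases le_or_gt 0 ((a + 2 + x) * (a + 2 + y)) with hs | hs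
  · unfold branchDenom
    rw [mul_add, mul_add, Finset.mul_sum, Finset.mul_sum]
    refine add_lt_add_of_lt_of_le (by nlinarith) (Finset.sum_le_sum fun α hα => ?_)
    have h0 := hr α hα
    have hcα := hc α hα
    have hinv : (α + 2 + y)⁻¹ ≤ (α + 2 + x)⁻¹ := by
      gcongr
      linarith
    calc (a + 2 + x) * (c α * ((a + 2 + y) / (α + 2 + y)))
        = c α * ((a + 2 + x) * (a + 2 + y)) * (α + 2 + y)⁻¹ := by ring
      _ ≤ c α * ((a + 2 + x) * (a + 2 + y)) * (α + 2 + x)⁻¹ := by gcongr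
      _ = _ := by ring
  · have h1 : a + 2 + x < 0 := by nlinarith
    have h2 : 0 < a + 2 + y := by nlinarith
    nlinarith [mul_pos h2 hHx, mul_pos (neg_pos.2 h1) hHy]

lemma exists_branch_eq (hT : T.Nonempty) (hca : 0 < c a) (hc : ∀ α ∈ T, 0 < c α)
    (ha : ∀ α ∈ T, a < α) (hra : a + 2 + r < 0) (hr : ∀ α ∈ T, 0 < α + 2 + r)
    (hr0 : branchDenom T c a r = 0) (y : ℝ) :
    ∃ x, r < x ∧ (a + 2 + x) / branchDenom T c a x = y := by
  set C := c a + ∑ α ∈ T, c α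
  have hC : 0 < C := add_pos_of_pos_of_nonneg hca (Finset.sum_nonneg fun α hα => (hc α hα).le)
  set z := -a - 2 + |y| * C + 1
  have hyC : 0 ≤ |y| * C := by positivity
  have hrz : r < z := by linarith
  have hHz : 0 < branchDenom T c a z := hr0 ▸ branchDenom_lt hT hc ha hr hrz
  have hHzC : branchDenom T c a z ≤ C := by
    unfold branchDenom
    refine add_le_add_right (Finset.sum_le_sum fun α hα => ?_) _
    refine mul_le_of_le_one_right (hc α hα).le ?_
    have := ha α hα
    rw [div_le_one (by linarith)]
    linarith
  have hcont : ContinuousOn (fun x => (a + 2 + x) - y * branchDenom T c a x) (Set.Icc r z) :=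
    ContinuousOn.sub (by fun_prop) (continuousOn_const.mul
      ((branchDenom_continuousOn hr).mono Set.Icc_subset_Ici_self))
  have hyz : y * branchDenom T c a z ≤ |y| * C :=
    mul_le_mul (le_abs_self y) hHzC hHz.le (abs_nonneg y)
  obtain ⟨x, ⟨hx1, -⟩, hx⟩ := intermediate_value_Icc hrz.le hcont
    (show (0 : ℝ) ∈ Set.Icc _ _ from ⟨by simp only [hr0]; linarith, by linarith⟩)
  have hrx : r < x := by
    refine hx1.lt_of_ne fun h => ?_
    subst h
    simp only [hr0] at hx
    linarith
  have hHx : 0 < branchDenom T c a x := hr0 ▸ branchDenom_lt hT hc ha hr hrx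
  refine ⟨x, hrx, ?_⟩
  rw [div_eq_iff hHx.ne']
  simp only at hx
  linarith

end Branch

section Omega

variable {ι : Type*} [Fintype ι] [DecidableEq ι] {A : Matrix ι ι ℝ}

/-- The residues of `ω_A(λ) / λ`, indexed by `α` for the pole `-α - 2`. -/
noncomputable def residue (A : Matrix ι ι ℝ) (α : ℝ) : ℝ :=
  projNormSq A α + if α = -2 then 1 else 0

lemma residue_pos {S : Finset ℝ} (hS : (S : Set ℝ) = mainEv A \ {(-2 : ℝ)}) {α : ℝ}
    (hα : α ∈ insert (-2) S) : 0 < residue A α := by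
  have h0 := projNormSq_nonneg A α
  unfold residue
  split_ifs with h
  · linarith
  · have hα : α ∈ (S : Set ℝ) := by simpa [h] using hα
    rw [hS] at hα
    have : projNormSq A α ≠ 0 := hα.1
    positivity

lemma omegaFun_zero_pos (A : Matrix ι ι ℝ) : 0 < omegaFun A 0 := by
  have := projNormSq_nonneg A (-2)
  simp only [omegaFun, zero_div, zero_mul, finsum_zero]
  linarith

lemma omegaFun_eq_mul_sum {S : Finset ℝ} (hS : (S : Set ℝ) = mainEv A \ {(-2 : ℝ)}) {x : ℝ}
    (hx : x ≠ 0) :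
    omegaFun A x = x * ∑ α ∈ insert (-2) S, residue A α / (α + 2 + x) := by
  have h2 : (-2 : ℝ) ∉ S := by
    rw [← Finset.mem_coe, hS]
    simp
  rw [Finset.sum_insert h2, omegaFun, ← hS, finsum_mem_coe_finset, mul_add, Finset.mul_sum]
  congr 1
  · rw [residue, if_pos rfl, neg_add_cancel, zero_add, mul_div_cancel₀ _ hx, add_comm]
  · refine Finset.sum_congr rfl fun α hα => ?_
    have : α ≠ -2 := fun h => h2 (h ▸ hα)
    simp only [residue, this, if_false]
    ring

lemma omegaFun_mul_eq {S : Finset ℝ} (hS : (S : Set ℝ) = mainEv A \ {(-2 : ℝ)}) {a x : ℝ}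
    (ha : a ∈ insert (-2) S) (hx : x ≠ 0) (hax : a + 2 + x ≠ 0) :
    omegaFun A x * (a + 2 + x) =
      x * branchDenom ((insert (-2) S).erase a) (residue A) a x := by
  rw [omegaFun_eq_mul_sum hS hx, ← Finset.add_sum_erase _ _ ha, branchDenom, mul_assoc, add_mul,
    Finset.sum_mul]
  congr 2
  · field_simp
  · exact Finset.sum_congr rfl fun α _ => by ring

end Omega

/-- With `-a - 2` the largest pole of `ω_A(λ) / λ`, on `(λ*, ∞)` the function `ψ_A` is the quotient
of `a + 2 + x` by `branchDenom`, which vanishes at `λ*`. -/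
lemma exists_branch {ι : Type*} [Fintype ι] [DecidableEq ι] {A : Matrix ι ι ℝ} (hk : 1 ≤ kA A) :
    ∃ (T : Finset ℝ) (c : ℝ → ℝ) (a : ℝ), IsLeast (mainEv A ∪ {(-2 : ℝ)}) a ∧
      T.Nonempty ∧ 0 < c a ∧ (∀ α ∈ T, 0 < c α) ∧ (∀ α ∈ T, a < α) ∧
      a + 2 + lamStar A < 0 ∧ (∀ α ∈ T, 0 < α + 2 + lamStar A) ∧
      branchDenom T c a (lamStar A) = 0 ∧
      ∀ x, lamStar A < x → psiFun A x = (a + 2 + x) / branchDenom T c a x := by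
  have hfin : (mainEv A \ {(-2 : ℝ)}).Finite :=
    Set.finite_of_ncard_ne_zero (Nat.one_le_iff_ne_zero.1 hk)
  have hne : (mainEv A \ {(-2 : ℝ)}).Nonempty :=
    Set.nonempty_of_ncard_ne_zero (Nat.one_le_iff_ne_zero.1 hk)
  obtain ⟨S, hS⟩ := hfin.exists_finset_coe
  have hmemS : ∀ α, α ∈ mainEv A \ {(-2 : ℝ)} ↔ α ∈ S := fun α => by
    rw [← hS, Finset.mem_coe]
  have hD : (insert (-2) S).Nonempty := Finset.insert_nonempty _ _
  set a := (insert (-2) S).min' hD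
  have haD : a ∈ insert (-2) S := Finset.min'_mem _ _
  set T := (insert (-2) S).erase a with hT_def
  have hT : T.Nonempty := by
    rw [hT_def, Finset.erase_nonempty haD]
    obtain ⟨β, hβ⟩ := hne
    refine ⟨-2, by simp, β, by simp [(hmemS β).1 hβ], fun h => hβ.2 ?_⟩
    simp [← h]
  have haT : ∀ α ∈ T, a < α := fun α hα =>
    lt_of_le_of_ne (Finset.min'_le _ _ (Finset.mem_of_mem_erase hα)) (Finset.ne_of_mem_erase hα).symm
  have hca : 0 < residue A a := residue_pos hS haD
  have hcT : ∀ α ∈ T, 0 < residue A α := fun α hα => residue_pos hS (Finset.mem_of_mem_erase hα)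
  obtain ⟨r, hra, hrT, hr0⟩ := exists_branchDenom_eq_zero hT hca hcT haT
  have hpole : ∀ x, r ≤ x → ∀ α ∈ insert (-2) S, α + 2 + x = 0 → α = a := fun x hx α hα h => by
    by_contra hne
    have := hrT α (Finset.mem_erase.2 ⟨hne, hα⟩)
    linarith
  have hpos : ∀ x, r < x → 0 < branchDenom T (residue A) a x := fun x hx =>
    hr0 ▸ branchDenom_lt hT hcT haT hrT hx
  have hne0 : ∀ x, r ≤ x → a + 2 + x ≠ 0 → x ≠ 0 := fun x hx hax h => by
    subst h
    have := hpole 0 hx (-2) (by simp) (by norm_num)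
    exact hax (by rw [← this]; norm_num)
  have hstar : lamStar A = r := by
    refine IsGreatest.csSup_eq ⟨⟨fun α hα h => ?_, ?_⟩, fun x ⟨hxD, hx⟩ => ?_⟩
    · have := hpole r le_rfl α (Finset.mem_insert_of_mem ((hmemS α).1 hα)) (by rw [h]; ring)
      rw [h, this] at hra
      linarith
    · have h := omegaFun_mul_eq hS haD (hne0 r le_rfl hra.ne) hra.ne
      rw [← hT_def, hr0, mul_zero] at h
      exact (mul_eq_zero.1 h).resolve_right hra.ne
    · by_contra! hrx
      have hx0 : x ≠ 0 := by
        rintro rfl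
        exact (omegaFun_zero_pos A).ne' hx
      have hax : a + 2 + x ≠ 0 := fun h => by
        have haS : a ∈ S := (Finset.mem_insert.1 haD).resolve_left fun h2 => hx0 (by linarith)
        exact hxD a ((hmemS a).2 haS) (by linarith)
      have h := omegaFun_mul_eq hS haD hx0 hax
      rw [hx, zero_mul] at h
      exact mul_ne_zero hx0 (hpos x hrx).ne' h.symm
  refine ⟨T, residue A, a, ?_, hT, hca, hcT, haT, hstar ▸ hra, hstar ▸ hrT, hstar ▸ hr0, ?_⟩
  · have : mainEv A ∪ {(-2 : ℝ)} = ((insert (-2) S : Finset ℝ) : Set ℝ) := by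
      rw [Finset.coe_insert, hS]
      ext
      simp
    rw [this]
    exact Finset.isLeast_min' _ _
  · rw [hstar]
    intro x hx
    by_cases hax : a + 2 + x = 0
    · rw [hax, zero_div, psiFun]
      split_ifs with h
      · rfl
      · have ha2 : a = -2 := (Finset.mem_insert.1 haD).resolve_right fun haS => h (by
          rw [hmemS, show -x - 2 = a by linarith]
          exact haS)
        rw [show x = 0 by linarith, zero_div]
    · have hnot : -x - 2 ∉ mainEv A \ {(-2 : ℝ)} := fun h => by
        have := hpole x hx.le _ (Finset.mem_insert_of_mem ((hmemS _).1 h)) (by ring)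
        exact hax (by rw [← this]; ring)
      have hx0 := hne0 x hx.le hax
      have h := omegaFun_mul_eq hS haD hx0 hax
      have hH := hpos x hx
      have hω : omegaFun A x ≠ 0 := fun h0 => by
        rw [h0, zero_mul] at h
        exact mul_ne_zero hx0 hH.ne' h.symm
      rw [psiFun, if_neg hnot, div_eq_div_iff hω hH.ne', ← h]
      ring

/-- Behaviour of the inverse `ψ_{A*}⁻¹` of the rightmost branch of
the ψ-function. -/
theorem psiStarInv_behaviour {n : ℕ} (hn : 1 ≤ n)
    (A : Matrix (Fin n) (Fin n) ℝ) (hA : A.IsSymm) (hk : 1 ≤ kA A) :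
    StrictMono (psiStarInv A) ∧
    Tendsto (psiStarInv A) atBot (𝓝 (lamStar A)) ∧
    Tendsto (psiStarInv A) atTop atTop ∧
    psiStarInv A 0 = -sInf (mainEv A ∪ {(-2 : ℝ)}) - 2 ∧
    (∀ y : ℝ, IsGreatest {lam : ℝ | psiFun A lam = y} (psiStarInv A y)) := by
  obtain ⟨T, c, a, hleast, hT, hca, hc, ha, hra, hr, hr0, hψ⟩ := exists_branch hk
  have hmono : StrictMonoOn (psiFun A) (Set.Ioi (lamStar A)) :=
    (branch_strictMono hT hca hc ha hr hr0).congr fun x hx => (hψ x hx).symm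
  have hinv : ∀ x, lamStar A < x → psiStarInv A (psiFun A x) = x := fun x hx => by
    have : {lam : ℝ | lamStar A < lam ∧ psiFun A lam = psiFun A x} = {x} := by
      ext z
      exact ⟨fun h => hmono.injOn h.1 hx h.2, fun h => by rw [h]; exact ⟨hx, rfl⟩⟩
    rw [psiStarInv, this, csSup_singleton]
  have hspec : ∀ y, lamStar A < psiStarInv A y ∧ psiFun A (psiStarInv A y) = y := fun y => by
    obtain ⟨x, hx, hxy⟩ := exists_branch_eq hT hca hc ha hra hr hr0 y
    rw [← hψ x hx] at hxy
    rw [← hxy, hinv x hx]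
    exact ⟨hx, rfl⟩
  have hstrict : StrictMono (psiStarInv A) := fun y z hyz => by
    rwa [← hmono.lt_iff_lt (hspec y).1 (hspec z).1, (hspec y).2, (hspec z).2]
  refine ⟨hstrict, ?_, ?_, ?_, fun y => ⟨(hspec y).2, fun x hx => ?_⟩⟩
  · refine tendsto_atBot_isGLB hstrict.monotone ?_
    have : Set.range (psiStarInv A) = Set.Ioi (lamStar A) := by
      ext x
      exact ⟨fun ⟨y, hy⟩ => hy ▸ (hspec y).1, fun hx => ⟨_, hinv x hx⟩⟩
    rw [this]
    exact isGLB_Ioi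
  · refine tendsto_atTop_atTop_of_monotone hstrict.monotone fun b => ?_
    refine ⟨psiFun A (max b (lamStar A + 1)), ?_⟩
    rw [hinv _ (lt_max_of_lt_right (lt_add_one _))]
    exact le_max_left _ _
  · have hlt : lamStar A < -a - 2 := by linarith
    rw [hleast.csInf_eq, ← hinv _ hlt, hψ _ hlt]
    simp
  · have hx : psiFun A x = y := hx
    rcases le_or_gt x (lamStar A) with h | h
    · exact h.trans (hspec y).1.le
    · rw [← hx, hinv x h]

end QECPaper
end

section
/- Let G = (V₁,E₁) be a connected graph with |V₁| ≥ 2 and H = (V₂,E₂) a κ-regular graph on n = |V₂| vertices (n ≥ 1, κ ≥ 0) with adjacency matrix A_H. Define F(λ') = (1/2)·[ (n+1)λ' − (κ+2) + √( ((n+1)λ' − (κ+2))² + 4(κ+2)λ' ) ]. If (i) −2 − F(QEC(G)) ∉ ev(A_H) and (ii) −2 − min ev(A_H) ≤ −(κ+2)/(n+1), then QEC(G⊙H) = F(QEC(G)). (Here F = ψ_{H*}⁻¹, since for a κ-regular H on n vertices ψ_H(λ) = λ(λ+κ+2)/((n+1)λ+κ+2) and λ* = −(κ+2)/(n+1).)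 -/
open scoped BigOperators
open Filter Topology
open scoped Classical

namespace QECPaper

/-- The height of a vertex of the cone: its distance to the apex. -/
def coneHeight {V : Type*} : Option V → ℕ
  | none => 0
  | some _ => 1

/-- The graph distance in the cone over `H`. -/
noncomputable def coneDist {V : Type*} (H : SimpleGraph V) (x y : Option V) : ℕ :=
  if x = y then 0 else if (cone H).Adj x y then 1 else 2

/-- The graph distance in the corona of `G` and `H`. -/
noncomputable def coronaDist {V₁ V₂ : Type*} (G : SimpleGraph V₁) (H : SimpleGraph V₂)
    (p q : V₁ × Option V₂) : ℕ :=
  if p.1 = q.1 then coneDist H p.2 q.2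
  else G.dist p.1 q.1 + coneHeight p.2 + coneHeight q.2

lemma coneDist_self {V : Type*} (H : SimpleGraph V) (x : Option V) : coneDist H x x = 0 := by
  simp [coneDist]

lemma coneDist_le_two {V : Type*} (H : SimpleGraph V) (x y : Option V) :
    coneDist H x y ≤ 2 := by
  unfold coneDist; split_ifs <;> omega

lemma coneDist_none {V : Type*} (H : SimpleGraph V) (y : Option V) :
    coneDist H none y = coneHeight y := by
  cases y <;> simp [coneDist, coneHeight, cone]

lemma coneDist_none_right {V : Type*} (H : SimpleGraph V) (x : Option V) :
    coneDist H x none = coneHeight x := by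
  cases x <;> simp [coneDist, coneHeight, cone]

lemma coneHeight_le_one {V : Type*} (x : Option V) : coneHeight x ≤ 1 := by
  cases x <;> simp [coneHeight]

lemma coneDist_le_of_adj {V : Type*} (H : SimpleGraph V) {x x' : Option V}
    (h : (cone H).Adj x x') (y : Option V) : coneDist H x y ≤ 1 + coneDist H x' y := by
  by_cases hy : x' = y
  · subst hy
    simp [coneDist, h]
    split_ifs <;> omega
  · have h1 : 1 ≤ coneDist H x' y := by
      unfold coneDist; split_ifs <;> omega
    have := coneDist_le_two H x y
    omega

lemma coronaDist_le_of_adj {V₁ V₂ : Type*} {G : SimpleGraph V₁} (hG : G.Connected)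
    (H : SimpleGraph V₂) {p p' : V₁ × Option V₂} (h : (corona G H).Adj p p')
    (q : V₁ × Option V₂) : coronaDist G H p q ≤ 1 + coronaDist G H p' q := by
  obtain ⟨i, x⟩ := p
  obtain ⟨i', x'⟩ := p'
  obtain ⟨j, y⟩ := q
  rcases h with ⟨h1, h2⟩ | ⟨h1, h2, h3⟩
  · simp only at h1 h2
    subst h1
    by_cases hij : i = j
    · simpa [coronaDist, hij] using coneDist_le_of_adj H h2 y
    · have := coneHeight_le_one x
      simp only [coronaDist, hij, if_false]
      omega
  · simp only at h1 h2 h3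
    subst h2 h3
    have hne := h1.ne
    have hd : G.dist i i' = 1 := SimpleGraph.dist_eq_one_iff_adj.2 h1
    have ht := hG.dist_triangle (u := i) (v := i') (w := j)
    have hy := coneHeight_le_one y
    by_cases hij : i = j
    · subst hij
      simp only [coronaDist, if_true, coneDist_none]
      omega
    · by_cases hij' : i' = j
      · subst hij'
        simp only [coronaDist, hij, if_true, if_false, coneDist_none, hd]
        simp [coneHeight]
      · simp only [coronaDist, hij, hij', if_false]
        omega

lemma coronaDist_le_length {V₁ V₂ : Type*} {G : SimpleGraph V₁} (hG : G.Connected)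
    (H : SimpleGraph V₂) {p q : V₁ × Option V₂} (w : (corona G H).Walk p q) :
    coronaDist G H p q ≤ w.length := by
  induction w with
  | nil => simp [coronaDist, coneDist_self]
  | cons h w ih =>
    have := coronaDist_le_of_adj hG H h
    rw [SimpleGraph.Walk.length_cons]
    exact (this _).trans (by omega)

/-- The embedding of `G` into its corona with `H` as the set of apices. -/
def apexHom {V₁ V₂ : Type*} (G : SimpleGraph V₁) (H : SimpleGraph V₂) : G →g corona G H where
  toFun i := (i, none)
  map_rel' h := Or.inr ⟨h, rfl, rfl⟩

lemma exists_walk_apex {V₁ V₂ : Type*} (G : SimpleGraph V₁) (H : SimpleGraph V₂) (i : V₁)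
    (x : Option V₂) : ∃ w : (corona G H).Walk (i, x) (i, none), w.length = coneHeight x := by
  cases x with
  | none => exact ⟨.nil, rfl⟩
  | some a =>
    have h : (corona G H).Adj (i, some a) (i, none) := Or.inl ⟨rfl, by simp [cone]⟩
    exact ⟨h.toWalk, rfl⟩

lemma exists_walk_via_apices {V₁ V₂ : Type*} {G : SimpleGraph V₁} (hG : G.Connected)
    (H : SimpleGraph V₂) (i j : V₁) (x y : Option V₂) :
    ∃ w : (corona G H).Walk (i, x) (j, y),
      w.length = G.dist i j + coneHeight x + coneHeight y := by
  obtain ⟨w₁, h₁⟩ := exists_walk_apex G H i x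
  obtain ⟨w₂, h₂⟩ := exists_walk_apex G H j y
  obtain ⟨w, hw⟩ := hG.exists_walk_length_eq_dist i j
  obtain ⟨w₃, h₃⟩ : ∃ w₃ : (corona G H).Walk (i, none) (j, none), w₃.length = G.dist i j :=
    ⟨w.map (apexHom G H), (SimpleGraph.Walk.length_map _ _).trans hw⟩
  refine ⟨(w₁.append w₃).append w₂.reverse, ?_⟩
  simp only [SimpleGraph.Walk.length_append, SimpleGraph.Walk.length_reverse]
  omega

lemma exists_walk_coronaDist {V₁ V₂ : Type*} {G : SimpleGraph V₁} (hG : G.Connected)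
    (H : SimpleGraph V₂) (p q : V₁ × Option V₂) :
    ∃ w : (corona G H).Walk p q, w.length ≤ coronaDist G H p q := by
  obtain ⟨i, x⟩ := p
  obtain ⟨j, y⟩ := q
  obtain ⟨w, hw⟩ := exists_walk_via_apices hG H i j x y
  by_cases hij : i = j
  · subst hij
    by_cases hxy : x = y
    · subst hxy
      exact ⟨.nil, by simp⟩
    · by_cases hadj : (cone H).Adj x y
      · have h : (corona G H).Adj (i, x) (i, y) := Or.inl ⟨rfl, hadj⟩
        exact ⟨h.toWalk, by simp [coronaDist, coneDist, hxy, hadj]⟩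
      · refine ⟨w, ?_⟩
        have := coneHeight_le_one x
        have := coneHeight_le_one y
        simp [coronaDist, coneDist, hxy, hadj, hw]
        omega
  · exact ⟨w, by simp [coronaDist, hij, hw]⟩

lemma corona_dist {V₁ V₂ : Type*} {G : SimpleGraph V₁} (hG : G.Connected)
    (H : SimpleGraph V₂) (p q : V₁ × Option V₂) :
    (corona G H).dist p q = coronaDist G H p q := by
  obtain ⟨w, hw⟩ := exists_walk_coronaDist hG H p q
  obtain ⟨w', hw'⟩ := w.reachable.exists_walk_length_eq_dist
  exact le_antisymm ((SimpleGraph.dist_le w).trans hw)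
    (hw' ▸ coronaDist_le_length hG H w')

/-- The amount by which the distance in the cone falls short of the distance through the apex. -/
noncomputable def coneDefect {V : Type*} [DecidableEq V] (H : SimpleGraph V)
    [DecidableRel H.Adj] : Option V → Option V → ℝ
  | some a, some b => (H.adjMatrix ℝ + (2 : ℝ) • (1 : Matrix V V ℝ)) a b
  | _, _ => 0

lemma coneDist_eq_sub_coneDefect {V : Type*} [DecidableEq V] (H : SimpleGraph V)
    [DecidableRel H.Adj] (x y : Option V) :
    (coneDist H x y : ℝ) = coneHeight x + coneHeight y - coneDefect H x y := by
  cases x with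
  | none => simp [coneDist_none, coneDefect, coneHeight]
  | some a =>
    cases y with
    | none => simp [coneDist_none_right, coneDefect, coneHeight]
    | some b =>
      by_cases hab : a = b
      · subst hab
        simp [coneDist, coneDefect, coneHeight]
        norm_num
      · by_cases hadj : H.Adj a b
        · simp [coneDist, coneDefect, coneHeight, hab, hadj, cone]
        · simp [coneDist, coneDefect, coneHeight, hab, hadj, cone]
          norm_num

lemma corona_dist_eq {V₁ V₂ : Type*} [DecidableEq V₂] {G : SimpleGraph V₁} (hG : G.Connected)
    (H : SimpleGraph V₂) [DecidableRel H.Adj] (i j : V₁) (x y : Option V₂) :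
    ((corona G H).dist (i, x) (j, y) : ℝ) =
      G.dist i j + coneHeight x + coneHeight y - if i = j then coneDefect H x y else 0 := by
  rw [corona_dist hG]
  by_cases hij : i = j
  · subst hij
    simp [coronaDist, coneDist_eq_sub_coneDefect]
  · simp [coronaDist, hij]

lemma corona_quadForm {V₁ V₂ : Type*} [Fintype V₁] [Fintype V₂] [DecidableEq V₂]
    {G : SimpleGraph V₁} (hG : G.Connected) (H : SimpleGraph V₂) [DecidableRel H.Adj]
    (f : V₁ × Option V₂ → ℝ) (hf : ∑ p, f p = 0) :
    ∑ p, ∑ q, f p * ((corona G H).dist p q : ℝ) * f q =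
      (∑ i, ∑ j, (∑ x, f (i, x)) * (G.dist i j : ℝ) * (∑ y, f (j, y))) -
      ∑ i, ∑ a, ∑ b, f (i, some a) *
        (H.adjMatrix ℝ + (2 : ℝ) • (1 : Matrix V₂ V₂ ℝ)) a b * f (i, some b) := by
  have hterm : ∀ p q : V₁ × Option V₂, f p * ((corona G H).dist p q : ℝ) * f q =
      f p * (G.dist p.1 q.1 : ℝ) * f q + (f p * coneHeight p.2) * f q
        + f p * (coneHeight q.2 * f q)
        - if p.1 = q.1 then f p * coneDefect H p.2 q.2 * f q else 0 := by
    rintro ⟨i, x⟩ ⟨j, y⟩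
    rw [corona_dist_eq hG]
    split_ifs <;> ring
  simp only [hterm, Finset.sum_sub_distrib, Finset.sum_add_distrib]
  rw [← Finset.sum_mul_sum, ← Finset.sum_mul_sum, hf, mul_zero, zero_mul, add_zero, add_zero]
  congr 1
  · simp only [Fintype.sum_prod_type]
    refine Finset.sum_congr rfl fun i _ => ?_
    rw [Finset.sum_comm]
    refine Finset.sum_congr rfl fun j _ => ?_
    simp only [Finset.sum_mul, Finset.mul_sum]
    rw [Finset.sum_comm]
  · simp only [Fintype.sum_prod_type]
    refine Finset.sum_congr rfl fun i _ => ?_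
    simp only [Fintype.sum_option, coneDefect]
    simp

lemma sum_const_mul_quadForm {V : Type*} [Fintype V] (c : ℝ) (f : V → ℝ) (d : V → V → ℝ) :
    ∑ x, ∑ y, (c * f x) * d x y * (c * f y) = c ^ 2 * ∑ x, ∑ y, f x * d x y * f y := by
  simp only [Finset.mul_sum]
  exact Finset.sum_congr rfl fun x _ => Finset.sum_congr rfl fun y _ => by ring

lemma exists_scale_sum_sq {V : Type*} [Fintype V] {f : V → ℝ} (h : ∑ x, f x ^ 2 ≠ 0) :
    ∃ c : ℝ, c ^ 2 * ∑ x, f x ^ 2 = 1 := by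
  have hpos : 0 ≤ ∑ x, f x ^ 2 := Finset.sum_nonneg fun x _ => sq_nonneg _
  exact ⟨(Real.sqrt (∑ x, f x ^ 2))⁻¹, by
    rw [inv_pow, Real.sq_sqrt hpos, inv_mul_cancel₀ h]⟩

lemma QEC_eq_of_quadForm {V : Type*} [Fintype V] (G : SimpleGraph V) {l : ℝ}
    (hle : ∀ f : V → ℝ, ∑ x, f x = 0 →
      ∑ x, ∑ y, f x * (G.dist x y : ℝ) * f y ≤ l * ∑ x, f x ^ 2)
    {f : V → ℝ} (hf : ∑ x, f x = 0) (hne : ∑ x, f x ^ 2 ≠ 0)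
    (heq : ∑ x, ∑ y, f x * (G.dist x y : ℝ) * f y = l * ∑ x, f x ^ 2) : QEC G = l := by
  refine IsGreatest.csSup_eq ⟨?_, ?_⟩
  · obtain ⟨c, hc⟩ := exists_scale_sum_sq hne
    refine ⟨fun x => c * f x, ?_, ?_, ?_⟩
    · simp only [mul_pow, ← Finset.mul_sum, hc]
    · simp only [← Finset.mul_sum, hf, mul_zero]
    · rw [sum_const_mul_quadForm, heq]
      linear_combination (-l) * hc
  · rintro r ⟨g, h1, h0, rfl⟩
    simpa [h1] using hle g h0

lemma QEC_isGreatest {V : Type*} [Fintype V] (G : SimpleGraph V) (hV : 2 ≤ Fintype.card V) :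
    IsGreatest {r : ℝ | ∃ f : V → ℝ, (∑ x, f x ^ 2) = 1 ∧ (∑ x, f x) = 0 ∧
      r = ∑ x, ∑ y, f x * (G.dist x y : ℝ) * f y} (QEC G) := by
  let S : Set (V → ℝ) := {f | (∑ x, f x ^ 2) = 1 ∧ (∑ x, f x) = 0}
  have hclosed : IsClosed S :=
    (isClosed_eq (by fun_prop) continuous_const).inter
      (isClosed_eq (by fun_prop) continuous_const)
  have hcomp : IsCompact S := by
    refine (isCompact_univ_pi fun _ : V => isCompact_Icc (a := (-1 : ℝ)) (b := 1)).of_isClosed_subset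
      hclosed ?_
    rintro f ⟨h1, -⟩ x -
    have : f x ^ 2 ≤ 1 := h1 ▸ Finset.single_le_sum (f := fun x => f x ^ 2)
      (fun y _ => sq_nonneg _) (Finset.mem_univ x)
    exact abs_le.1 ((sq_le_one_iff_abs_le_one _).1 this)
  have hne : S.Nonempty := by
    obtain ⟨a, b, hab⟩ := Fintype.exists_pair_of_one_lt_card (α := V) (by omega)
    let f : V → ℝ := fun x => (if x = a then 1 else 0) - (if x = b then 1 else 0)
    have h0 : ∑ x, f x = 0 := by simp [f]
    have h2 : ∑ x, f x ^ 2 ≠ 0 := by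
      have : f a ^ 2 ≤ ∑ x, f x ^ 2 := Finset.single_le_sum (f := fun x => f x ^ 2)
        (fun y _ => sq_nonneg _) (Finset.mem_univ a)
      have ha : f a = 1 := by simp [f, hab]
      rw [ha] at this
      intro h
      linarith
    obtain ⟨c, hc⟩ := exists_scale_sum_sq h2
    refine ⟨fun x => c * f x, ?_, ?_⟩
    · simp only [mul_pow, ← Finset.mul_sum, hc]
    · simp only [← Finset.mul_sum, h0, mul_zero]
  obtain ⟨f, hf, hmax⟩ := hcomp.exists_isMaxOn hne
    (f := fun f => ∑ x, ∑ y, f x * (G.dist x y : ℝ) * f y) (by fun_prop)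
  have hgr : IsGreatest {r : ℝ | ∃ f : V → ℝ, (∑ x, f x ^ 2) = 1 ∧ (∑ x, f x) = 0 ∧
      r = ∑ x, ∑ y, f x * (G.dist x y : ℝ) * f y}
      (∑ x, ∑ y, f x * (G.dist x y : ℝ) * f y) := by
    refine ⟨⟨f, hf.1, hf.2, rfl⟩, ?_⟩
    rintro r ⟨g, h1, h0, rfl⟩
    exact hmax (show g ∈ S from ⟨h1, h0⟩)
  have : QEC G = _ := hgr.csSup_eq
  rwa [this]

lemma quadForm_le_QEC_mul {V : Type*} [Fintype V] (G : SimpleGraph V)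
    (hV : 2 ≤ Fintype.card V) (f : V → ℝ) (hf : ∑ x, f x = 0) :
    ∑ x, ∑ y, f x * (G.dist x y : ℝ) * f y ≤ QEC G * ∑ x, f x ^ 2 := by
  by_cases h : ∑ x, f x ^ 2 = 0
  · have hz : ∀ x, f x = 0 := fun x => by
      simpa using (Finset.sum_eq_zero_iff_of_nonneg fun x _ => sq_nonneg (f x)).1 h x
        (Finset.mem_univ x)
    simp [hz]
  · obtain ⟨c, hc⟩ := exists_scale_sum_sq h
    have hle := (QEC_isGreatest G hV).2 ⟨fun x => c * f x, by
      simp only [mul_pow, ← Finset.mul_sum, hc], by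
      simp only [← Finset.mul_sum, hf, mul_zero], rfl⟩
    rw [sum_const_mul_quadForm] at hle
    have hs : 0 ≤ ∑ x, f x ^ 2 := Finset.sum_nonneg fun x _ => sq_nonneg _
    have := mul_le_mul_of_nonneg_right hle hs
    calc _ = c ^ 2 * (∑ x, ∑ y, f x * (G.dist x y : ℝ) * f y) * ∑ x, f x ^ 2 := by
          linear_combination (-(∑ x, ∑ y, f x * (G.dist x y : ℝ) * f y)) * hc
      _ ≤ _ := this

lemma posSemidef_add_smul_one {ι : Type*} [Fintype ι] [DecidableEq ι] {A : Matrix ι ι ℝ}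
    (hA : A.IsHermitian) {c : ℝ} (h : ∀ β ∈ evSet A, -β ≤ c) :
    (A + c • (1 : Matrix ι ι ℝ)).PosSemidef := by
  have hH : (A + c • (1 : Matrix ι ι ℝ)).IsHermitian := by
    refine hA.add ?_
    simp [Matrix.IsHermitian]
  rw [hH.posSemidef_iff_eigenvalues_nonneg]
  intro i
  have hv := hH.mulVec_eigenvectorBasis i
  have hmem : hH.eigenvalues i - c ∈ evSet A := by
    refine ⟨hH.eigenvectorBasis i, ?_, ?_⟩
    · intro h0
      exact hH.eigenvectorBasis.orthonormal.ne_zero i (by ext j; exact congrFun h0 j)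
    · rw [Matrix.add_mulVec, Matrix.smul_mulVec, Matrix.one_mulVec] at hv
      rw [sub_smul, ← hv, add_sub_cancel_right]
  have := h _ hmem
  simp only [Pi.zero_apply]
  linarith

lemma sum_nonneg_of_posSemidef {ι : Type*} [Fintype ι] {M : Matrix ι ι ℝ} (hM : M.PosSemidef)
    (h : ι → ℝ) : 0 ≤ ∑ a, ∑ b, h a * M a b * h b := by
  have := hM.dotProduct_mulVec_nonneg h
  simpa [dotProduct, Matrix.mulVec, Finset.mul_sum, mul_assoc] using this

/-- A quadratic form with constant row sums, shifted along the all-ones vector. -/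
lemma sum_shift_const {ι : Type*} [Fintype ι] {M : Matrix ι ι ℝ} {c : ℝ}
    (hrow : ∀ a, ∑ b, M a b = c) (hcol : ∀ b, ∑ a, M a b = c) (h : ι → ℝ) (t : ℝ) :
    ∑ a, ∑ b, (h a - t) * M a b * (h b - t) =
      (∑ a, ∑ b, h a * M a b * h b) - 2 * t * c * (∑ a, h a) + t ^ 2 * c * Fintype.card ι := by
  have hterm : ∀ a b, (h a - t) * M a b * (h b - t) =
      h a * M a b * h b - (t * h a) * M a b - M a b * (t * h b) + t ^ 2 * M a b := by
    intro a b; ring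
  simp only [hterm, Finset.sum_add_distrib, Finset.sum_sub_distrib]
  have e1 : ∑ a, ∑ b, t * h a * M a b = t * c * ∑ a, h a := by
    simp only [← Finset.mul_sum, hrow, ← Finset.sum_mul]; ring
  have e2 : ∑ a, ∑ b, M a b * (t * h b) = t * c * ∑ a, h a := by
    rw [Finset.sum_comm]
    simp only [← Finset.sum_mul, hcol, ← Finset.mul_sum]; ring
  have e3 : ∑ a, ∑ b, t ^ 2 * M a b = t ^ 2 * c * Fintype.card ι := by
    simp only [← Finset.mul_sum, hrow, Finset.sum_const, Finset.card_univ, nsmul_eq_mul]; ring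
  rw [e1, e2, e3]; ring

lemma sum_quadForm_add_smul_one {ι : Type*} [Fintype ι] [DecidableEq ι] (M : Matrix ι ι ℝ)
    (c : ℝ) (h : ι → ℝ) :
    ∑ a, ∑ b, h a * (M + c • (1 : Matrix ι ι ℝ)) a b * h b =
      (∑ a, ∑ b, h a * M a b * h b) + c * ∑ a, h a ^ 2 := by
  simp only [Matrix.add_apply, Matrix.smul_apply, mul_add, add_mul, Finset.sum_add_distrib,
    Matrix.one_apply]
  congr 1
  rw [Finset.mul_sum]
  refine Finset.sum_congr rfl fun a _ => ?_
  simp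
  ring

/-- The larger root of `l * (l + k) = q * (N * l + k)` lies to the right of `-k / N`. -/
lemma larger_root_spec {N k q l : ℝ} (hN : 1 < N) (hk : 0 < k)
    (hl : l = (N * q - k + Real.sqrt ((N * q - k) ^ 2 + 4 * k * q)) / 2) :
    l * (l + k) = q * (N * l + k) ∧ 0 < N * l + k := by
  have hN0 : 0 < N := by linarith
  have hdisc : (N * q - k + 2 * k / N) ^ 2 < (N * q - k) ^ 2 + 4 * k * q := by
    have e : (N * q - k) ^ 2 + 4 * k * q - (N * q - k + 2 * k / N) ^ 2 =
        4 * k ^ 2 * (N - 1) / N ^ 2 := by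
      field_simp; ring
    have : 0 < 4 * k ^ 2 * (N - 1) / N ^ 2 :=
      div_pos (mul_pos (by positivity) (by linarith)) (by positivity)
    linarith
  have hlt := Real.lt_sqrt_of_sq_lt ((sq_abs (N * q - k + 2 * k / N)).trans_lt hdisc)
  have hneg := neg_abs_le (N * q - k + 2 * k / N)
  have hsq := Real.sq_sqrt ((sq_nonneg (N * q - k + 2 * k / N)).trans hdisc.le)
  set s := Real.sqrt ((N * q - k) ^ 2 + 4 * k * q)
  refine ⟨?_, ?_⟩
  · subst hl
    linear_combination hsq / 4
  · have h1 : -(k / N) < l := by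
      have : 2 * k / N = 2 * (k / N) := by ring
      rw [hl]; linarith
    have h2 : N * (k / N) = k := by field_simp
    nlinarith

/-- Completing the square in the form governing a single fibre of the corona. -/
lemma fibre_form_eq_neg_sq {n k q l : ℝ} (hn : n ≠ 0) (hpos : 0 < (n + 1) * l + k)
    (hroot : l * (l + k) = q * ((n + 1) * l + k)) (g s : ℝ) :
    q * g ^ 2 - l * (g - s) ^ 2 - (k + l) * s ^ 2 / n =
      -(n * l * g - ((n + 1) * l + k) * s) ^ 2 / (n * ((n + 1) * l + k)) := by
  rw [eq_div_iff (mul_ne_zero hn hpos.ne')]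
  field_simp
  linear_combination (-(g ^ 2) * n) * hroot

lemma adjMatrix_add_smul_one_row_sum {V : Type*} [Fintype V] [DecidableEq V]
    {H : SimpleGraph V} [DecidableRel H.Adj] {κ : ℕ} (hreg : H.IsRegularOfDegree κ) (c : ℝ)
    (a : V) : ∑ b, (H.adjMatrix ℝ + c • (1 : Matrix V V ℝ)) a b = κ + c := by
  have hd : (H.degree a : ℝ) = κ := by rw [hreg a]
  have hs : ∑ b, H.adjMatrix ℝ a b = κ := by
    have := H.adjMatrix_mulVec_const_apply (a := (1 : ℝ)) (v := a)
    simpa [Matrix.mulVec, dotProduct, hd] using this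
  simp only [Matrix.add_apply, Finset.sum_add_distrib, hs]
  simp [Matrix.one_apply]

lemma adjMatrix_add_smul_one_col_sum {V : Type*} [Fintype V] [DecidableEq V]
    {H : SimpleGraph V} [DecidableRel H.Adj] {κ : ℕ} (hreg : H.IsRegularOfDegree κ) (c : ℝ)
    (b : V) : ∑ a, (H.adjMatrix ℝ + c • (1 : Matrix V V ℝ)) a b = κ + c := by
  rw [← adjMatrix_add_smul_one_row_sum hreg c b]
  refine Finset.sum_congr rfl fun a _ => ?_
  simp [Matrix.one_apply, SimpleGraph.adjMatrix_apply, H.adj_comm, eq_comm]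

/-- Explicit main formula for `QEC(G⊙H)` when `H` is `κ`-regular. -/
theorem qec_corona_regular {V₁ V₂ : Type*} [Fintype V₁] [Fintype V₂] [DecidableEq V₂]
    (G : SimpleGraph V₁) (H : SimpleGraph V₂) [DecidableRel H.Adj]
    (hG : G.Connected) (hV₁ : 2 ≤ Fintype.card V₁) (hV₂ : 1 ≤ Fintype.card V₂)
    (κ : ℕ) (hreg : H.IsRegularOfDegree κ)
    (hev : -2 - (((Fintype.card V₂ : ℝ) + 1) * QEC G - ((κ : ℝ) + 2) +
        Real.sqrt ((((Fintype.card V₂ : ℝ) + 1) * QEC G - ((κ : ℝ) + 2)) ^ 2 +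
          4 * ((κ : ℝ) + 2) * QEC G)) / 2 ∉ evSet (H.adjMatrix ℝ))
    (hmin : ∀ β ∈ evSet (H.adjMatrix ℝ),
      -2 - β ≤ -((κ : ℝ) + 2) / ((Fintype.card V₂ : ℝ) + 1)) :
    QEC (corona G H) =
      (((Fintype.card V₂ : ℝ) + 1) * QEC G - ((κ : ℝ) + 2) +
        Real.sqrt ((((Fintype.card V₂ : ℝ) + 1) * QEC G - ((κ : ℝ) + 2)) ^ 2 +
          4 * ((κ : ℝ) + 2) * QEC G)) / 2 := by
  set n : ℝ := (Fintype.card V₂ : ℝ) with hn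
  set q : ℝ := QEC G with hq
  have hn1 : (1 : ℝ) ≤ n := by rw [hn]; exact_mod_cast hV₂
  have hn0 : n ≠ 0 := by linarith
  have hk : (0 : ℝ) < (κ : ℝ) + 2 := by positivity
  obtain ⟨l, hl⟩ : ∃ l : ℝ, l = ((n + 1) * q - ((κ : ℝ) + 2) +
      Real.sqrt (((n + 1) * q - ((κ : ℝ) + 2)) ^ 2 + 4 * ((κ : ℝ) + 2) * q)) / 2 := ⟨_, rfl⟩
  rw [← hl]
  obtain ⟨hroot, hpos⟩ := larger_root_spec (by linarith) hk hl
  have hsq := fibre_form_eq_neg_sq hn0 hpos hroot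
  set m : ℝ := (n + 1) * l + ((κ : ℝ) + 2) with hm
  have hm0 : m ≠ 0 := hpos.ne'
  set B : Matrix V₂ V₂ ℝ := H.adjMatrix ℝ + (2 : ℝ) • (1 : Matrix V₂ V₂ ℝ) with hB
  have hBl : B + l • (1 : Matrix V₂ V₂ ℝ) =
      H.adjMatrix ℝ + (2 + l) • (1 : Matrix V₂ V₂ ℝ) := by
    rw [add_smul, ← add_assoc]
  have hPSD : (B + l • (1 : Matrix V₂ V₂ ℝ)).PosSemidef := by
    rw [hBl]
    refine posSemidef_add_smul_one ?_ fun β hβ => ?_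
    · rw [Matrix.IsHermitian, Matrix.conjTranspose_eq_transpose_of_trivial]
      exact H.isSymm_adjMatrix
    · have h1 := hmin β hβ
      have h2 : -((κ : ℝ) + 2) / (n + 1) ≤ l := by
        rw [div_le_iff₀ (by linarith)]; linarith
      linarith
  have hfibre : ∀ h : V₂ → ℝ, ((κ : ℝ) + 2 + l) * (∑ a, h a) ^ 2 / n ≤
      (∑ a, ∑ b, h a * B a b * h b) + l * ∑ a, h a ^ 2 := by
    intro h
    have h1 := sum_nonneg_of_posSemidef hPSD fun a => h a - (∑ a, h a) / n
    rw [sum_shift_const (c := κ + (2 + l))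
      (by rw [hBl]; exact adjMatrix_add_smul_one_row_sum hreg _)
      (by rw [hBl]; exact adjMatrix_add_smul_one_col_sum hreg _),
      sum_quadForm_add_smul_one, ← hn] at h1
    have e : 2 * ((∑ a, h a) / n) * (κ + (2 + l)) * (∑ a, h a) -
        ((∑ a, h a) / n) ^ 2 * (κ + (2 + l)) * n =
        ((κ : ℝ) + 2 + l) * (∑ a, h a) ^ 2 / n := by
      field_simp; ring
    linarith
  have hupper : ∀ f : V₁ × Option V₂ → ℝ, ∑ p, f p = 0 →
      ∑ p, ∑ r, f p * ((corona G H).dist p r : ℝ) * f r ≤ l * ∑ p, f p ^ 2 := by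
    intro f hf
    rw [corona_quadForm hG H f hf]
    have hg : ∑ i, ∑ x, f (i, x) = 0 := by rw [← hf, Fintype.sum_prod_type]
    have h1 := quadForm_le_QEC_mul G hV₁ (fun i => ∑ x, f (i, x)) hg
    have h2 : q * ∑ i, (∑ x, f (i, x)) ^ 2 ≤
        (∑ i, ∑ a, ∑ b, f (i, some a) * B a b * f (i, some b)) + l * ∑ p, f p ^ 2 := by
      rw [Fintype.sum_prod_type, Finset.mul_sum, Finset.mul_sum, ← Finset.sum_add_distrib]
      refine Finset.sum_le_sum fun i _ => ?_
      have h3 := hfibre fun a => f (i, some a)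
      have h4 := hsq (∑ x, f (i, x)) (∑ a, f (i, some a))
      have h5 : 0 ≤ (n * l * (∑ x, f (i, x)) - m * (∑ a, f (i, some a))) ^ 2 / (n * m) := by
        positivity
      rw [neg_div] at h4
      simp only [Fintype.sum_option] at h4 h5 ⊢
      rw [add_sub_cancel_right] at h4
      linarith
    linarith
  obtain ⟨g, hg1, hg0, hgq⟩ := (QEC_isGreatest G hV₁).1
  let f : V₁ × Option V₂ → ℝ := fun p =>
    p.2.elim (g p.1 - n * (l * g p.1 / m)) fun _ => l * g p.1 / m
  have hfsum : ∀ i, ∑ x, f (i, x) = g i := by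
    intro i
    simp [f, Fintype.sum_option, ← hn]
  have hf0 : ∑ p, f p = 0 := by
    rw [Fintype.sum_prod_type]
    simpa only [hfsum] using hg0
  have hfne : ∑ p, f p ^ 2 ≠ 0 := by
    intro h
    have hz : ∀ p, f p = 0 := fun p => by
      simpa using (Finset.sum_eq_zero_iff_of_nonneg fun p _ => sq_nonneg (f p)).1 h p
        (Finset.mem_univ p)
    have hgz : ∀ i, g i = 0 := fun i => by rw [← hfsum i]; simp [hz]
    simp [hgz] at hg1
  refine QEC_eq_of_quadForm (corona G H) hupper hf0 hfne ?_
  rw [corona_quadForm hG H f hf0]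
  simp only [hfsum]
  rw [← hgq, sub_eq_iff_eq_add, Fintype.sum_prod_type, Finset.mul_sum,
    ← Finset.sum_add_distrib, ← hq, ← mul_one q, ← hg1, Finset.mul_sum]
  refine Finset.sum_congr rfl fun i _ => ?_
  have hform : ∑ a, ∑ b, f (i, some a) * B a b * f (i, some b) =
      n * (l * g i / m) ^ 2 * (κ + 2) := by
    simp only [f, Option.elim_some, ← Finset.sum_mul, ← Finset.mul_sum, hB,
      adjMatrix_add_smul_one_row_sum hreg, Finset.sum_const, Finset.card_univ, nsmul_eq_mul,
      ← hn]
    ring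
  have hnorm : ∑ x, f (i, x) ^ 2 =
      (g i - n * (l * g i / m)) ^ 2 + n * (l * g i / m) ^ 2 := by
    simp [f, Fintype.sum_option, ← hn]
  have h4 := hsq (g i) (n * (l * g i / m))
  have h5 : n * l * g i - m * (n * (l * g i / m)) = 0 := by field_simp; ring
  have h6 : ((κ : ℝ) + 2 + l) * (n * (l * g i / m)) ^ 2 / n =
      ((κ : ℝ) + 2 + l) * n * (l * g i / m) ^ 2 := by field_simp
  rw [h5, h6] at h4
  rw [hform, hnorm]
  linear_combination h4

end QECPaper
end
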